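/- Let λ be a nonzero real number and let n, k be positive integers, and assume λ ∉ {1, 2, …, k} (so that C(λ−1, k) ≠ 0). Then H_{n,λ}^{(k+1)} = ( (−1)^k / C(λ−1, k) ) · C(n+k, n) · ( H_{n+k,λ} − H_{k,λ} ), where C(x, m) = x(x−1)⋯(x−m+1)/m! is the generalized binomial coefficient. -/

import Mathlib

/-- Generalized binomial coefficient `C(x, n) = x(x-1)⋯(x-n+1)/n!`. -/
noncomputable def gbinom (x : ℝ) (n : ℕ) : ℝ :=
  (∏ i ∈ Finset.range n, (x - i)) / (Nat.factorial n)

/-- Degenerate harmonic numbers `H_{n,λ} = Σ_{j=1}^n (-1)^{j-1} (1/λ) C(λ, j)`, with `H_{0,λ} = 0`. -/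
noncomputable def degHarmonic (lam : ℝ) (n : ℕ) : ℝ :=
  ∑ j ∈ Finset.Icc 1 n, (-1 : ℝ) ^ (j - 1) * (1 / lam) * gbinom lam j

/-- Degenerate hyperharmonic numbers: `H_{0,λ}^{(r)} = 0`, `H_{n,λ}^{(1)} = H_{n,λ}`,
and `H_{n,λ}^{(r)} = Σ_{j=1}^n H_{j,λ}^{(r-1)}` for `r ≥ 2`. -/
noncomputable def degHyperharmonic (lam : ℝ) : ℕ → ℕ → ℝ
  | 0, _ => 0
  | 1, n => degHarmonic lam n
  | r + 2, n => ∑ j ∈ Finset.Icc 1 n, degHyperharmonic lam (r + 1) j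

/-- Harmonic numbers `H_n = Σ_{j=1}^n 1/j`, with `H_0 = 0`. -/
noncomputable def harmonicR (n : ℕ) : ℝ := ∑ j ∈ Finset.Icc 1 n, (1 : ℝ) / j

/-- Hyperharmonic numbers: `H_n^{(0)} = 1/n`, `H_n^{(1)} = H_n`,
and `H_n^{(r)} = Σ_{j=1}^n H_j^{(r-1)}` for `r ≥ 2` (and `H_0^{(r)} = 0`). -/
noncomputable def hyperharmonicR : ℕ → ℕ → ℝ
  | 0, n => if n = 0 then 0 else (1 : ℝ) / n
  | 1, n => harmonicR n
  | r + 2, n => ∑ j ∈ Finset.Icc 1 n, hyperharmonicR (r + 1) j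

/-- signed binomial `(-1)^m C(λ-1,m)` -/
noncomputable def sgb (lam : ℝ) (m : ℕ) : ℝ := (-1 : ℝ) ^ m * gbinom (lam - 1) m

theorem gbinom_succ (x : ℝ) (m : ℕ) :
    gbinom x (m + 1) = gbinom x m * ((x - m) / (m + 1)) := by
  have h : ((m.factorial : ℕ) : ℝ) ≠ 0 := by exact_mod_cast m.factorial_ne_zero
  have h2 : (m : ℝ) + 1 ≠ 0 := by positivity
  unfold gbinom
  rw [Finset.prod_range_succ, Nat.factorial_succ]
  push_cast
  field_simp

theorem sgb_succ (lam : ℝ) (m : ℕ) :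
    sgb lam (m + 1) = sgb lam m * ((m + 1 - lam) / (m + 1)) := by
  unfold sgb
  rw [gbinom_succ, pow_succ]
  ring

theorem gbinom_lam (lam : ℝ) (m : ℕ) :
    gbinom lam (m + 1) = lam / (m + 1) * gbinom (lam - 1) m := by
  induction m with
  | zero => simp [gbinom]
  | succ m ih =>
    rw [gbinom_succ, ih, gbinom_succ (lam - 1) m]
    have h2 : (m : ℝ) + 1 ≠ 0 := by positivity
    have h3 : (m : ℝ) + 1 + 1 ≠ 0 := by positivity
    push_cast
    field_simp
    ring

theorem degHarmonic_closed (lam : ℝ) (hlam : lam ≠ 0) (m : ℕ) :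
    degHarmonic lam m = (1 - sgb lam m) / lam := by
  induction m with
  | zero => simp [degHarmonic, sgb, gbinom]
  | succ m ih =>
    have h : degHarmonic lam (m + 1) = degHarmonic lam m
        + (-1 : ℝ) ^ m * (1 / lam) * gbinom lam (m + 1) := by
      unfold degHarmonic
      rw [Finset.sum_Icc_succ_top (by omega)]
      simp
    have h2 : (m : ℝ) + 1 ≠ 0 := by positivity
    rw [h, ih, sgb_succ, gbinom_lam]
    unfold sgb
    field_simp
    ring

theorem degHyper_aux (lam : ℝ) (hlam : lam ≠ 0) (k : ℕ)
    (hlam' : ∀ j ∈ Finset.Icc 1 k, lam ≠ (j : ℝ)) :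
    sgb lam k ≠ 0 ∧ ∀ n, degHyperharmonic lam (k + 1) n =
      ((n + k).choose n : ℝ) * ((sgb lam k - sgb lam (n + k)) / (lam * sgb lam k)) := by
  induction k with
  | zero =>
    have h0 : sgb lam 0 = 1 := by simp [sgb, gbinom]
    refine ⟨by simp [h0], fun n => ?_⟩
    simp [degHyperharmonic, degHarmonic_closed lam hlam, h0]
  | succ k ih =>
    obtain ⟨hb, ih⟩ := ih (fun j hj => hlam' j (by simp at hj ⊢; omega))
    have hne : (k : ℝ) + 1 - lam ≠ 0 := by
      have := hlam' (k + 1) (by simp)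
      push_cast at this
      exact fun h => this (by linarith)
    have h2 : (k : ℝ) + 1 ≠ 0 := by positivity
    have hb' : sgb lam (k + 1) ≠ 0 := by
      rw [sgb_succ]
      exact mul_ne_zero hb (div_ne_zero hne h2)
    refine ⟨hb', fun n => ?_⟩
    induction n with
    | zero => simp [degHyperharmonic]
    | succ n ihn =>
      have h : degHyperharmonic lam (k + 1 + 1) (n + 1) = degHyperharmonic lam (k + 1 + 1) n
          + degHyperharmonic lam (k + 1) (n + 1) := by
        simp only [degHyperharmonic]
        rw [Finset.sum_Icc_succ_top (by omega)]
      have e1 : n + 1 + (k + 1) = (n + k + 1) + 1 := by ring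
      have e2 : n + (k + 1) = n + k + 1 := by ring
      have e3 : n + 1 + k = n + k + 1 := by ring
      rw [h, ihn, ih, e1, e2, e3, sgb_succ lam (n + k + 1), sgb_succ lam k]
      have c1 : ((n + k + 1).choose n : ℝ) =
          ((n + k + 1).choose (n + 1) : ℝ) * (n + 1) / (k + 1) := by
        have := Nat.choose_succ_right_eq (n + k + 1) n
        rw [show n + k + 1 - n = k + 1 by omega] at this
        rw [eq_div_iff h2]
        exact_mod_cast this.symm
      have c2 : ((n + k + 1 + 1).choose (n + 1) : ℝ) =
          ((n + k + 1).choose n : ℝ) + ((n + k + 1).choose (n + 1) : ℝ) := by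
        exact_mod_cast Nat.choose_succ_succ (n + k + 1) n
      rw [c2, c1]
      have h3 : (n : ℝ) + k + 1 + 1 ≠ 0 := by positivity
      push_cast
      field_simp
      ring

/-- Theorem 3 of the paper:
`H_{n,λ}^{(k+1)} = ((-1)^k / C(λ-1,k)) C(n+k,n) (H_{n+k,λ} - H_{k,λ})`. -/
theorem degHyperharmonic_eq (lam : ℝ) (hlam : lam ≠ 0) (n k : ℕ) (hn : 1 ≤ n) (hk : 1 ≤ k)
    (hlam' : ∀ j ∈ Finset.Icc 1 k, lam ≠ (j : ℝ)) :
    degHyperharmonic lam (k + 1) n =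
      ((-1 : ℝ) ^ k / gbinom (lam - 1) k) * ((n + k).choose n : ℝ) *
        (degHarmonic lam (n + k) - degHarmonic lam k) := by
  obtain ⟨hb, h⟩ := degHyper_aux lam hlam k hlam'
  rw [h, degHarmonic_closed lam hlam, degHarmonic_closed lam hlam]
  have hs : (-1 : ℝ) ^ k / gbinom (lam - 1) k = 1 / sgb lam k := by
    unfold sgb
    rcases neg_one_pow_eq_or ℝ k with e | e <;> rw [e] <;> simp [neg_div, inv_neg]
  rw [hs]
  field_simp
  ring
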